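/- arXiv:2205.14559 — 3 statements merged into one kernel-verified Lean document; each statement's English description precedes it below -/
import Mathlib

section
/- There exists a constant c > 0 (one may take c = 12√2) such that for every n ≥ 1 and every projection angle θ ∈ [0, π), the expected projection length satisfies 𝔼[|proj_θ 𝒟_n(ω)|] ≤ c/n, where the expectation is over the i.i.d. uniform angle tree of height n. -/
open MeasureTheory Real Set

noncomputable section

/-- The uniform probability measure on the interval `[0, π/2]`. -/
def unif : Measure ℝ := (ENNReal.ofReal (π / 2))⁻¹ • volume.restrict (Set.Icc 0 (π / 2))

/-- An angle tree of height `n`: an angle in `ℝ` for every word over `{0,1,2,3}`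
of length `< n`. -/
abbrev AngleTree (n : ℕ) := ∀ k : Fin n, (Fin k → Fin 4) → ℝ

/-- The i.i.d. measure on angle trees of height `n`, each coordinate uniform on `[0, π/2]`. -/
def treeMeasure (n : ℕ) : Measure (AngleTree n) :=
  Measure.pi fun k => Measure.pi fun _ : Fin k → Fin 4 => unif

/-- The centre `c(ω, w)` of the disk indexed by the word `w` of length `n`. -/
def center {n : ℕ} (ω : AngleTree n) (w : Fin n → Fin 4) : ℂ :=
  ∑ k : Fin n, (3 / 4 : ℂ) * (4 : ℂ)⁻¹ ^ (k : ℕ) *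
    Complex.exp (((((w k : ℕ) : ℝ) * (π / 2) -
      ω k (fun i => w (Fin.castLE k.isLt.le i)) : ℝ) : ℂ) * Complex.I)

/-- The `n`-th generation random Cantor disks `𝒟_n(ω)`. -/
def cantorDisks {n : ℕ} (ω : AngleTree n) : Set ℂ :=
  ⋃ w : Fin n → Fin 4, Metric.closedBall (center ω w) ((4 : ℝ)⁻¹ ^ n)

/-- The orthogonal projection of `E ⊆ ℂ` onto the line `ℝ·e^{iθ}`, identified with `ℝ`. -/
def proj (θ : ℝ) (E : Set ℂ) : Set ℝ :=
  (fun z => (Complex.exp (-(θ : ℂ) * Complex.I) * z).re) '' E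

/-- The length of the projection of `E` in direction `θ`. -/
def projLen (θ : ℝ) (E : Set ℂ) : ℝ := (volume (proj θ E)).toReal

instance isProbabilityMeasure_unif : IsProbabilityMeasure unif := by
  refine ⟨?_⟩
  have h : ENNReal.ofReal (π / 2) ≠ 0 := by simpa using pi_pos
  simp only [unif, Measure.smul_apply, Measure.restrict_apply_univ, Real.volume_Icc, sub_zero,
    smul_eq_mul]
  exact ENNReal.inv_mul_cancel h ENNReal.ofReal_ne_top

instance isProbabilityMeasure_treeMeasure (n : ℕ) : IsProbabilityMeasure (treeMeasure n) := by
  unfold treeMeasure; infer_instance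

/-- A measure giving every box of nested products the right mass is the nested product measure. -/
theorem nested_pi_eq {n : ℕ} {ν : Measure (AngleTree n)}
    (h : ∀ s : ∀ k : Fin n, (Fin k → Fin 4) → Set ℝ, (∀ k v, MeasurableSet (s k v)) →
      ν (Set.pi univ fun k => Set.pi univ (s k)) = ∏ k, ∏ v, unif (s k v)) :
    treeMeasure n = ν := by
  refine Measure.pi_eq_generateFrom
    (C := fun k : Fin n => Set.pi univ '' Set.pi univ
      (fun _ : Fin k → Fin 4 => {s : Set ℝ | MeasurableSet s}))
    (fun _ => generateFrom_pi) (fun _ => isPiSystem_pi)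
    (fun k => ⟨fun _ => univ, fun _ => ⟨fun _ => univ, by simp, by simp⟩, by simp,
      iUnion_const _⟩) fun s hs => ?_
  choose t ht hts using hs
  have e : s = fun k => Set.pi univ (t k) := funext fun k => (hts k).symm
  rw [e, h t fun k v => ht k v (mem_univ _)]
  simp only [Measure.pi_pi]

/-- The tree of height `n + 1` with root angle `p.1` and the four subtrees `p.2`. -/
def graft {n : ℕ} (p : ℝ × (Fin 4 → AngleTree n)) : AngleTree (n + 1) := fun k =>
  Fin.cases (motive := fun k : Fin (n + 1) => (Fin k → Fin 4) → ℝ) (fun _ => p.1)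
    (fun k (v : Fin (k + 1) → Fin 4) => p.2 (v 0) k fun i => v i.succ) k

theorem graft_zero {n : ℕ} (p : ℝ × (Fin 4 → AngleTree n)) (v) : graft p 0 v = p.1 := rfl

theorem graft_succ {n : ℕ} (p : ℝ × (Fin 4 → AngleTree n)) (k : Fin n)
    (v : Fin (k + 1) → Fin 4) : graft p k.succ v = p.2 (v 0) k fun i => v i.succ := rfl

theorem measurable_graft {n : ℕ} : Measurable (graft (n := n)) := by
  refine measurable_pi_lambda _ fun k => measurable_pi_lambda _ fun v => ?_
  induction k using Fin.cases with
  | zero => exact measurable_fst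
  | succ k =>
    change Fin (k + 1) → Fin 4 at v
    change Measurable fun p : ℝ × (Fin 4 → AngleTree n) => p.2 (v 0) k fun i => v i.succ
    fun_prop

theorem measurePreserving_graft (n : ℕ) :
    MeasurePreserving graft (unif.prod (Measure.pi fun _ : Fin 4 => treeMeasure n))
      (treeMeasure (n + 1)) := by
  refine ⟨measurable_graft, (nested_pi_eq fun s hs => ?_).symm⟩
  have hpre : graft ⁻¹' (Set.pi univ fun k => Set.pi univ (s k)) =
      s 0 default ×ˢ (Set.pi univ fun j => Set.pi univ fun k : Fin n =>
        Set.pi univ fun v : Fin k → Fin 4 => s k.succ (Fin.cons j v : Fin (k + 1) → Fin 4)) := by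
    ext p
    simp only [mem_preimage, mem_pi, mem_univ, true_imp_iff, mem_prod]
    constructor
    · intro h
      exact ⟨h 0 default, fun j k v => by
        simpa [graft_succ] using h k.succ (Fin.cons j v : Fin (k + 1) → Fin 4)⟩
    · rintro ⟨h0, h1⟩ k
      induction k using Fin.cases with
      | zero =>
        intro v
        change Fin 0 → Fin 4 at v
        rw [Subsingleton.elim v default]
        exact h0
      | succ k =>
        intro v
        change Fin (k + 1) → Fin 4 at v
        have := h1 (v 0) k fun i => v i.succ
        rw [graft_succ]
        convert! this
        exact (Fin.cons_self_tail (n := k) (α := fun _ => Fin 4) v).symm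
  rw [Measure.map_apply measurable_graft
    (.univ_pi fun k => .univ_pi fun v => hs k v), hpre, Measure.prod_prod]
  simp only [Measure.pi_pi, treeMeasure]
  rw [Finset.prod_comm, Fin.prod_univ_succ (n := n)]
  congr 1
  · exact (Fintype.prod_subsingleton (ι := Fin 0 → Fin 4) (fun v => unif (s 0 v)) default).symm
  · refine Finset.prod_congr rfl fun k _ => ?_
    rw [← Fintype.prod_prod_type']
    exact Fintype.prod_equiv (Fin.consEquiv fun _ : Fin (k + 1) => Fin 4) _
      (fun v : Fin (k + 1) → Fin 4 => unif (s k.succ v)) fun _ => rfl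

/-- The signed coordinate of the orthogonal projection of `z` in direction `θ`. -/
def projCoord (θ : ℝ) (z : ℂ) : ℝ := (Complex.exp (-(θ : ℂ) * Complex.I) * z).re

theorem norm_exp_neg_mul_I (θ : ℝ) : ‖Complex.exp (-(θ : ℂ) * Complex.I)‖ = 1 := by
  simpa using Complex.norm_exp_ofReal_mul_I (-θ)

theorem projCoord_add (θ : ℝ) (z z' : ℂ) :
    projCoord θ (z + z') = projCoord θ z + projCoord θ z' := by
  simp [projCoord, mul_add]

theorem projCoord_sub (θ : ℝ) (z z' : ℂ) :
    projCoord θ (z - z') = projCoord θ z - projCoord θ z' := by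
  simp [projCoord, mul_sub]

theorem projCoord_real_mul (θ r : ℝ) (z : ℂ) : projCoord θ (r * z) = r * projCoord θ z := by
  rw [projCoord, mul_left_comm, Complex.re_ofReal_mul, projCoord]

theorem projCoord_exp (θ a : ℝ) : projCoord θ (Complex.exp (a * Complex.I)) = cos (a - θ) := by
  rw [projCoord, ← Complex.exp_add, ← Complex.exp_ofReal_mul_I_re]
  congr 2
  push_cast
  ring

theorem abs_projCoord_le (θ : ℝ) (z : ℂ) : |projCoord θ z| ≤ ‖z‖ := by
  refine (Complex.abs_re_le_norm _).trans ?_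
  rw [norm_mul, norm_exp_neg_mul_I, one_mul]

theorem mem_proj_cantorDisks {n : ℕ} {θ x : ℝ} {ω : AngleTree n} :
    x ∈ proj θ (cantorDisks ω) ↔ ∃ w, |x - projCoord θ (center ω w)| ≤ (4 : ℝ)⁻¹ ^ n := by
  simp only [proj, cantorDisks, mem_image, mem_iUnion, Metric.mem_closedBall, dist_eq_norm]
  constructor
  · rintro ⟨z, ⟨w, hw⟩, rfl⟩
    refine ⟨w, le_trans ?_ hw⟩
    have := abs_projCoord_le θ (z - center ω w)
    rwa [projCoord_sub] at this
  · rintro ⟨w, hw⟩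
    refine ⟨center ω w + ((x - projCoord θ (center ω w) : ℝ) : ℂ) * Complex.exp (θ * Complex.I),
      ⟨w, ?_⟩, ?_⟩
    · rw [add_sub_cancel_left, norm_mul, Complex.norm_exp_ofReal_mul_I, mul_one,
        Complex.norm_real]
      exact hw
    · change projCoord θ _ = x
      rw [projCoord_add, projCoord_real_mul, projCoord_exp]
      simp

theorem norm_center_le {n : ℕ} (ω : AngleTree n) (w : Fin n → Fin 4) :
    ‖center ω w‖ ≤ 1 - (4 : ℝ)⁻¹ ^ n := by
  refine (norm_sum_le _ _).trans ?_
  simp only [norm_mul, Complex.norm_exp_ofReal_mul_I, mul_one, norm_pow, norm_inv, norm_div,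
    Complex.norm_ofNat]
  rw [Fin.sum_univ_eq_sum_range (fun k => (3 / 4 : ℝ) * (4 : ℝ)⁻¹ ^ k), ← Finset.mul_sum,
    geom_sum_eq (by norm_num)]
  apply le_of_eq
  ring

theorem abs_le_one_of_mem_proj {n : ℕ} {θ x : ℝ} {ω : AngleTree n}
    (hx : x ∈ proj θ (cantorDisks ω)) : |x| ≤ 1 := by
  obtain ⟨w, hw⟩ := mem_proj_cantorDisks.1 hx
  have h := (abs_projCoord_le θ _).trans (norm_center_le ω w)
  rw [abs_le] at *
  constructor <;> linarith

theorem center_graft {n : ℕ} (p : ℝ × (Fin 4 → AngleTree n)) (j : Fin 4) (v : Fin n → Fin 4) :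
    center (graft p) (Fin.cons j v : Fin (n + 1) → Fin 4) =
      ((3 / 4 : ℝ) : ℂ) * Complex.exp (((j : ℕ) * (π / 2) - p.1 : ℝ) * Complex.I) +
        ((1 / 4 : ℝ) : ℂ) * center (p.2 j) v := by
  simp only [_root_.center]
  rw [Fin.sum_univ_succ, Finset.mul_sum]
  congr 1
  · rw [graft_zero]
    simp
  · refine Finset.sum_congr rfl fun k _ => ?_
    rw [graft_succ]
    have h : (fun i : Fin k => (Fin.cons j v : Fin (n + 1) → Fin 4)
        (Fin.castLE (Nat.succ_le_succ k.isLt.le) i.succ)) = fun i => v (Fin.castLE k.isLt.le i) :=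
      rfl
    have h0 : (Fin.cons j v : Fin (n + 1) → Fin 4)
        (Fin.castLE (Nat.succ_le_succ k.isLt.le) (0 : Fin (k + 1))) = j := rfl
    simp only [Fin.val_succ, Fin.cons_succ, pow_succ]
    erw [h, h0]
    push_cast
    ring

theorem mem_proj_graft {n : ℕ} {θ x : ℝ} {p : ℝ × (Fin 4 → AngleTree n)} :
    x ∈ proj θ (cantorDisks (graft p)) ↔
      ∃ j : Fin 4, 4 * x - 3 * cos ((j : ℕ) * (π / 2) - p.1 - θ) ∈
        proj θ (cantorDisks (p.2 j)) := by
  simp only [mem_proj_cantorDisks]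
  rw [← (Fin.consEquiv fun _ : Fin (n + 1) => Fin 4).exists_congr_right, Prod.exists]
  refine exists_congr fun j => exists_congr fun v => ?_
  change |x - projCoord θ (center (graft p) (Fin.cons j v : Fin (n + 1) → Fin 4))| ≤ _ ↔ _
  rw [center_graft, projCoord_add, projCoord_real_mul, projCoord_real_mul, projCoord_exp, pow_succ]
  have h (a b : ℝ) : 4 * x - 3 * a - b = 4 * (x - (3 / 4 * a + 1 / 4 * b)) := by ring
  rw [h, abs_mul, abs_of_pos (four_pos : (0 : ℝ) < 4)]
  constructor <;> intro <;> linarith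

theorem measurableSet_mem_proj (n : ℕ) (θ : ℝ) :
    MeasurableSet {p : AngleTree n × ℝ | p.2 ∈ proj θ (cantorDisks p.1)} := by
  simp only [mem_proj_cantorDisks, ofPred_exists]
  refine .iUnion fun w => measurableSet_le ?_ measurable_const
  unfold projCoord _root_.center
  fun_prop

open scoped ENNReal

theorem four_mul_lintegral_comp {f : ℝ → ℝ≥0∞} (hf : Measurable f) (c : ℝ) :
    4 * ∫⁻ x, f (4 * x - c) = ∫⁻ x, f x := by
  have h : Measurable fun x => f (x - c) := by fun_prop
  rw [← lintegral_sub_right_eq_self f c]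
  conv_rhs => rw [← Real.smul_map_volume_mul_left (four_ne_zero : (4 : ℝ) ≠ 0)]
  rw [lintegral_smul_measure, lintegral_map h (measurable_const_mul 4)]
  simp

/-- The autocorrelation of `f`. -/
def autocorr (f : ℝ → ℝ≥0∞) (t : ℝ) : ℝ≥0∞ := ∫⁻ y, f y * f (y + t)

theorem measurable_autocorr {f : ℝ → ℝ≥0∞} (hf : Measurable f) : Measurable (autocorr f) :=
  Measurable.lintegral_prod_right' (f := fun p : ℝ × ℝ => f p.2 * f (p.2 + p.1)) (by fun_prop)

theorem lintegral_autocorr {f : ℝ → ℝ≥0∞} (hf : Measurable f) :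
    ∫⁻ t, autocorr f t = (∫⁻ x, f x) ^ 2 := by
  simp only [autocorr]
  rw [lintegral_lintegral_swap (by fun_prop)]
  have h (y : ℝ) : ∫⁻ t, f y * f (y + t) = f y * ∫⁻ x, f x := by
    rw [lintegral_const_mul _ (by fun_prop), lintegral_add_left_eq_self]
  simp only [h]
  rw [lintegral_mul_const _ hf, sq]

theorem setLIntegral_autocorr {f : ℝ → ℝ≥0∞} (hf : Measurable f)
    (hs : ∀ x, 1 < |x| → f x = 0) :
    ∫⁻ t in Icc (-2) 2, autocorr f t = (∫⁻ x, f x) ^ 2 := by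
  rw [← lintegral_autocorr hf]
  refine setLIntegral_eq_of_support_subset fun t ht => ?_
  by_contra h
  refine ht ?_
  rw [autocorr, lintegral_eq_zero_iff (by fun_prop)]
  refine .of_forall fun y => ?_
  by_contra hy
  obtain ⟨h1, h2⟩ := mul_ne_zero_iff.1 hy
  have h1' := not_lt.1 fun H => h1 (hs _ H)
  have h2' := not_lt.1 fun H => h2 (hs _ H)
  rw [abs_le] at h1' h2'
  exact h ⟨by linarith, by linarith⟩

theorem cos_add_sin_sub_pi_div_four (r : ℝ) :
    cos (r - π / 4) + sin (r - π / 4) = √2 * sin r := by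
  rw [cos_sub, sin_sub, cos_pi_div_four, sin_pi_div_four]
  ring

theorem setLIntegral_le_lintegral_cos_add_sin {K : ℝ → ℝ≥0∞} (hK : Measurable K) :
    ∫⁻ t in Icc (-2) 2, K t ≤ 6 * ∫⁻ s in Ioc (-π) (-π + 2 * π), K (3 * (cos s + sin s)) := by
  have h2 : (1 : ℝ) ≤ √2 := by rw [Real.one_le_sqrt]; norm_num
  have h2' : √2 ≤ (2 : ℝ) := by rw [Real.sqrt_le_iff]; norm_num
  have hinj : InjOn (fun r => 3 * √2 * sin r) (Icc (-(π / 2)) (π / 2)) := fun a ha b hb h =>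
    injOn_sin ha hb (mul_left_cancel₀ (by positivity) h)
  have hsub : Icc (-2) 2 ⊆ (fun r => 3 * √2 * sin r) '' Icc (-(π / 2)) (π / 2) := by
    intro t ht
    refine ⟨arcsin (t / (3 * √2)), arcsin_mem_Icc _, ?_⟩
    have h3 : 0 < 3 * √2 := by positivity
    simp only
    rw [sin_arcsin, mul_div_cancel₀ _ h3.ne']
    · rw [le_div_iff₀ h3]; linarith [ht.1]
    · rw [div_le_iff₀ h3]; linarith [ht.2]
  calc ∫⁻ t in Icc (-2) 2, K t
      ≤ ∫⁻ t in (fun r => 3 * √2 * sin r) '' Icc (-(π / 2)) (π / 2), K t :=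
        lintegral_mono_set hsub
    _ = ∫⁻ r in Icc (-(π / 2)) (π / 2),
          ENNReal.ofReal |3 * √2 * cos r| * K (3 * √2 * sin r) :=
        lintegral_image_eq_lintegral_abs_deriv_mul measurableSet_Icc
          (fun r _ => ((hasDerivAt_sin r).const_mul _).hasDerivWithinAt) hinj K
    _ ≤ ∫⁻ r in Icc (-(π / 2)) (π / 2), 6 * K (3 * √2 * sin r) := by
        refine lintegral_mono fun r => mul_le_mul_left ?_ _
        refine ENNReal.ofReal_le_of_le_toReal ?_
        rw [abs_mul, abs_of_pos (by positivity)]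
        have := abs_cos_le_one r
        have := abs_nonneg (cos r)
        norm_num
        nlinarith
    _ = 6 * ∫⁻ r in Icc (-(π / 2)) (π / 2), K (3 * √2 * sin r) :=
        lintegral_const_mul _ (by fun_prop)
    _ ≤ 6 * ∫⁻ s in Ioc (-π) (-π + 2 * π), K (3 * (cos s + sin s)) := by
        gcongr 6 * ?_
        rw [← lintegral_indicator measurableSet_Icc, ← lintegral_indicator measurableSet_Ioc,
          ← lintegral_sub_right_eq_self
            (fun s => (Ioc (-π) (-π + 2 * π)).indicator _ s) (π / 4)]
        refine lintegral_mono fun r => ?_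
        have := pi_pos
        by_cases hr : r ∈ Icc (-(π / 2)) (π / 2)
        · rw [indicator_of_mem hr,
            indicator_of_mem (mem_Ioc.2 ⟨by linarith [hr.1], by linarith [hr.2]⟩),
            cos_add_sin_sub_pi_div_four, mul_assoc]
        · rw [indicator_of_notMem hr]
          exact zero_le

theorem setLIntegral_comp_sub_left (H : ℝ → ℝ≥0∞) (a b c : ℝ) :
    ∫⁻ u in Icc a b, H (c - u) = ∫⁻ s in Icc (c - b) (c - a), H s := by
  rw [← lintegral_indicator measurableSet_Icc, ← lintegral_indicator measurableSet_Icc,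
    ← lintegral_sub_left_eq_self ((Icc (c - b) (c - a)).indicator H) c]
  refine lintegral_congr fun u => ?_
  simp only [indicator, mem_Icc, sub_le_sub_iff_left]
  simp only [and_comm]

theorem setLIntegral_period_le {H : ℝ → ℝ≥0∞} (hH : Measurable H)
    (hp : Function.Periodic H (2 * π)) (θ a : ℝ) :
    ∫⁻ s in Ioc a (a + 2 * π), H s ≤
      2 * ∫⁻ u, ∑ j : Fin 4, H ((j : ℕ) * (π / 2) - u - θ) ∂unif := by
  have : Fact (0 < 2 * π) := ⟨two_pi_pos⟩
  have hper (b : ℝ) : ∫⁻ s in Ioc b (b + 2 * π), H s =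
      ∫⁻ z : AddCircle (2 * π), hp.lift z := by
    rw [← AddCircle.lintegral_preimage (2 * π) b]
    rfl
  rw [hper a, ← hper (-(π / 2) - θ), unif, lintegral_smul_measure, smul_eq_mul, ← mul_assoc]
  have hcover : Ioc (-(π / 2) - θ) (-(π / 2) - θ + 2 * π) ⊆
      ⋃ j : Fin 4, Icc ((j : ℕ) * (π / 2) - θ - π / 2) ((j : ℕ) * (π / 2) - θ - 0) := by
    intro s hs
    rw [mem_iUnion]
    by_contra! h
    have h0 := h 0
    have h1 := h 1
    have h2 := h 2
    have h3 := h 3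
    simp only [mem_Icc, not_and_or, not_le, Fin.val_zero, Fin.val_one, Fin.val_two] at h0 h1 h2 h3
    have e3 : ((3 : Fin 4) : ℕ) = 3 := rfl
    rw [e3] at h3
    obtain ⟨l, r⟩ := hs
    push_cast at h0 h1 h2 h3
    rcases h0 with h0 | h0 <;> rcases h1 with h1 | h1 <;> rcases h2 with h2 | h2 <;>
      rcases h3 with h3 | h3 <;> linarith
  have hone : 1 ≤ 2 * (ENNReal.ofReal (π / 2))⁻¹ := by
    rw [← div_eq_mul_inv, ENNReal.le_div_iff_mul_le (by simp [pi_pos]) (by simp), one_mul]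
    refine ENNReal.ofReal_le_of_le_toReal ?_
    norm_num
    linarith [pi_le_four]
  refine le_trans ?_ (le_mul_of_one_le_left' hone)
  rw [lintegral_finsetSum _ fun j _ => by fun_prop]
  have hj (j : Fin 4) : ∫⁻ u in Icc 0 (π / 2), H ((j : ℕ) * (π / 2) - u - θ) =
      ∫⁻ s in Icc ((j : ℕ) * (π / 2) - θ - π / 2) ((j : ℕ) * (π / 2) - θ - 0), H s := by
    rw [← setLIntegral_comp_sub_left]
    simp only [sub_right_comm]
  simp only [hj]
  refine (lintegral_mono_set hcover).trans ((lintegral_iUnion_le _ _).trans ?_)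
  rw [tsum_fintype]

theorem cos_quarter_turn (j : Fin 4) (u θ : ℝ) :
    cos (((j + 1 : Fin 4) : ℕ) * (π / 2) - u - θ) = - sin ((j : ℕ) * (π / 2) - u - θ) := by
  rw [← cos_add_pi_div_two]
  fin_cases j
  · congr 1; simp; ring
  · congr 1; simp; ring
  · congr 1
    change ((3 : ℕ) : ℝ) * _ - _ - _ = ((2 : ℕ) : ℝ) * _ - _ - _ + _
    push_cast; ring
  · rw [← cos_add_two_pi]
    congr 1
    change ((0 : ℕ) : ℝ) * _ - _ - _ + _ = ((3 : ℕ) : ℝ) * _ - _ - _ + _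
    push_cast; ring

/-- The union bound for four independent events, improved by the overlaps of consecutive pairs. -/
theorem four_mul_measure_exists_add_le {Ω : Type*} [MeasurableSpace Ω] (μ : Measure Ω)
    [IsProbabilityMeasure μ] {B : Fin 4 → Set Ω} (hB : ∀ j, MeasurableSet (B j)) :
    4 * Measure.pi (fun _ : Fin 4 => μ) {T | ∃ j, T j ∈ B j} +
      ∑ j, μ (B j) * μ (B (j + 1)) ≤ 4 * ∑ j, μ (B j) := by
  classical
  set P := Measure.pi fun _ : Fin 4 => μ
  let E (j : Fin 4) : Set (Fin 4 → Ω) := {T | T j ∈ B j}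
  have hE (j) : MeasurableSet (E j) := measurable_pi_apply j (hB j)
  have hPE (j) : P (E j) = μ (B j) :=
    (measurePreserving_eval (fun _ : Fin 4 => μ) j).measure_preimage (hB j).nullMeasurableSet
  have hinter (j) : P (E j ∩ E (j + 1)) = μ (B j) * μ (B (j + 1)) := by
    have h : E j ∩ E (j + 1) =
        Set.pi univ fun i => if i = j ∨ i = j + 1 then B i else univ := by
      ext T
      simp only [E, mem_inter_iff, mem_ofPred_eq, mem_pi, mem_univ, true_imp_iff]
      constructor
      · rintro ⟨h1, h2⟩ i
        split_ifs with hi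
        · rcases hi with rfl | rfl <;> assumption
        · trivial
      · intro h
        exact ⟨by simpa using h j, by simpa using h (j + 1)⟩
    rw [h, Measure.pi_pi]
    fin_cases j <;> simp [Fin.prod_univ_four, mul_comm]
  have hU : MeasurableSet {T : Fin 4 → Ω | ∃ j, T j ∈ B j} := by
    rw [ofPred_exists]
    exact .iUnion hE
  simp only [← hinter]
  simp only [← hPE]
  simp only [← lintegral_indicator_one ((hE _).inter (hE _))]
  simp only [← lintegral_indicator_one hU, ← lintegral_indicator_one (hE _)]
  rw [← lintegral_finsetSum _ fun j _ => (measurable_one.indicator ((hE _).inter (hE _))),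
    ← lintegral_finsetSum _ fun j _ => (measurable_one.indicator (hE _)),
    ← lintegral_const_mul _ (measurable_one.indicator hU),
    ← lintegral_const_mul _ (Finset.measurable_sum _ fun j _ => measurable_one.indicator (hE _)),
    ← lintegral_add_left ((measurable_one.indicator hU).const_mul _)]
  refine lintegral_mono fun T => ?_
  simp only [indicator, E, mem_inter_iff, mem_ofPred_eq, Pi.one_apply, Fin.sum_univ_four,
    Fin.exists_fin_succ, Fin.isValue]
  by_cases h0 : T 0 ∈ B 0 <;> by_cases h1 : T 1 ∈ B 1 <;> by_cases h2 : T 2 ∈ B 2 <;>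
    by_cases h3 : T 3 ∈ B 3 <;> simp [h0, h1, h2, h3] <;> norm_num

/-- The probability that `x` lies in the projection of the `n`-th generation in direction `θ`. -/
def hitProb (θ : ℝ) (n : ℕ) (x : ℝ) : ℝ≥0∞ := treeMeasure n {ω | x ∈ proj θ (cantorDisks ω)}

theorem measurable_hitProb (θ : ℝ) (n : ℕ) : Measurable (hitProb θ n) :=
  measurable_measure_prodMk_right (measurableSet_mem_proj n θ)

theorem measurableSet_hit (θ : ℝ) (n : ℕ) (x : ℝ) :
    MeasurableSet {ω : AngleTree n | x ∈ proj θ (cantorDisks ω)} :=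
  measurable_prodMk_right (measurableSet_mem_proj n θ)

theorem hitProb_eq_zero {θ : ℝ} {n : ℕ} {x : ℝ} (hx : 1 < |x|) : hitProb θ n x = 0 := by
  have h : {ω : AngleTree n | x ∈ proj θ (cantorDisks ω)} = ∅ :=
    eq_empty_of_forall_notMem fun ω hω => (abs_le_one_of_mem_proj hω).not_gt hx
  rw [hitProb, h, measure_empty]

theorem lintegral_hitProb_le_two (θ : ℝ) (n : ℕ) : ∫⁻ x, hitProb θ n x ≤ 2 := by
  calc ∫⁻ x, hitProb θ n x = ∫⁻ x in Icc (-1) 1, hitProb θ n x := by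
        refine (setLIntegral_eq_of_support_subset fun x hx => ?_).symm
        exact abs_le.1 (not_lt.1 fun h => hx (hitProb_eq_zero h))
    _ ≤ ∫⁻ x in Icc (-1 : ℝ) 1, 1 := lintegral_mono fun x => prob_le_one
    _ = 2 := by
        rw [setLIntegral_one, Real.volume_Icc]
        norm_num

theorem lintegral_volume_proj (θ : ℝ) (n : ℕ) :
    ∫⁻ ω, volume (proj θ (cantorDisks ω)) ∂treeMeasure n = ∫⁻ x, hitProb θ n x := by
  have hm := measurableSet_mem_proj n θ
  exact (Measure.prod_apply hm).symm.trans (Measure.prod_apply_symm hm)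

theorem four_mul_hitProb_succ_add_le (θ : ℝ) (n : ℕ) (x : ℝ) :
    4 * hitProb θ (n + 1) x +
      ∫⁻ u, ∑ j : Fin 4, hitProb θ n (4 * x - 3 * cos ((j : ℕ) * (π / 2) - u - θ)) *
        hitProb θ n (4 * x - 3 * cos (((j + 1 : Fin 4) : ℕ) * (π / 2) - u - θ)) ∂unif ≤
      4 * ∫⁻ u, ∑ j : Fin 4, hitProb θ n (4 * x - 3 * cos ((j : ℕ) * (π / 2) - u - θ)) ∂unif := by
  have hm := measurable_hitProb θ n
  have hS := (measurePreserving_graft n).measurable (measurableSet_hit θ (n + 1) x)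
  rw [hitProb, ← (measurePreserving_graft n).measure_preimage
    (measurableSet_hit θ (n + 1) x).nullMeasurableSet, Measure.prod_apply hS,
    ← lintegral_const_mul _ (measurable_measure_prodMk_left hS),
    ← lintegral_const_mul _ (by fun_prop),
    ← lintegral_add_right _ (by fun_prop)]
  refine lintegral_mono fun u => ?_
  have := four_mul_measure_exists_add_le (treeMeasure n) fun j : Fin 4 =>
    measurableSet_hit θ n (4 * x - 3 * cos ((j : ℕ) * (π / 2) - u - θ))
  have e : Prod.mk u ⁻¹' (graft ⁻¹' {ω : AngleTree (n + 1) | x ∈ proj θ (cantorDisks ω)}) =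
      {T : Fin 4 → AngleTree n | ∃ j : Fin 4, T j ∈ {ω : AngleTree n |
        4 * x - 3 * cos ((j : ℕ) * (π / 2) - u - θ) ∈ proj θ (cantorDisks ω)}} :=
    ext fun T => mem_proj_graft (p := (u, T))
  rw [e]
  exact this

theorem lintegral_hitProb_recursion (θ : ℝ) (n : ℕ) :
    192 * (∫⁻ x, hitProb θ (n + 1) x) + (∫⁻ x, hitProb θ n x) ^ 2 ≤
      192 * ∫⁻ x, hitProb θ n x := by
  set h := hitProb θ n
  have hm : Measurable h := measurable_hitProb θ n
  have hK : Measurable (autocorr h) := measurable_autocorr hm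
  have m1 : Measurable (Function.uncurry fun x u : ℝ => ∑ j : Fin 4,
      h (4 * x - 3 * cos ((j : ℕ) * (π / 2) - u - θ))) := by
    simp only [Function.uncurry_def]
    fun_prop
  have m2 : Measurable (Function.uncurry fun x u : ℝ => ∑ j : Fin 4,
      h (4 * x - 3 * cos ((j : ℕ) * (π / 2) - u - θ)) *
        h (4 * x - 3 * cos (((j + 1 : Fin 4) : ℕ) * (π / 2) - u - θ))) := by
    simp only [Function.uncurry_def]
    fun_prop
  have hint := lintegral_mono (μ := volume) fun x => four_mul_hitProb_succ_add_le θ n x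
  rw [lintegral_add_left ((measurable_hitProb θ (n + 1)).const_mul 4),
    lintegral_const_mul _ (measurable_hitProb θ (n + 1)),
    lintegral_const_mul _ m1.lintegral_prod_right, lintegral_lintegral_swap m2.aemeasurable,
    lintegral_lintegral_swap m1.aemeasurable] at hint
  have hright (u : ℝ) :
      4 * ∫⁻ x, ∑ j : Fin 4, h (4 * x - 3 * cos ((j : ℕ) * (π / 2) - u - θ)) =
        4 * ∫⁻ x, h x := by
    rw [lintegral_finsetSum _ fun j _ => by fun_prop, Finset.mul_sum]
    simp only [four_mul_lintegral_comp hm]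
    simp
  have hleft (u : ℝ) :
      4 * ∫⁻ x, ∑ j : Fin 4, h (4 * x - 3 * cos ((j : ℕ) * (π / 2) - u - θ)) *
          h (4 * x - 3 * cos (((j + 1 : Fin 4) : ℕ) * (π / 2) - u - θ)) =
        ∑ j : Fin 4, autocorr h (3 * (cos ((j : ℕ) * (π / 2) - u - θ) +
          sin ((j : ℕ) * (π / 2) - u - θ))) := by
    rw [lintegral_finsetSum _ fun j _ => by fun_prop, Finset.mul_sum]
    refine Finset.sum_congr rfl fun j _ => ?_
    rw [autocorr, cos_quarter_turn, ← four_mul_lintegral_comp (f := fun y => h y * h (y + _))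
      (by fun_prop) (3 * cos ((j : ℕ) * (π / 2) - u - θ))]
    congr 1
    refine lintegral_congr fun x => ?_
    congr 2
    ring
  have hR : 4 * (4 * ∫⁻ u, ∫⁻ x, ∑ j : Fin 4,
      h (4 * x - 3 * cos ((j : ℕ) * (π / 2) - u - θ)) ∂volume ∂unif) = 16 * ∫⁻ x, h x := by
    rw [← lintegral_const_mul' 4 _ (by simp)]
    simp only [hright]
    rw [lintegral_const, measure_univ, mul_one, ← mul_assoc]
    norm_num
  have hL : (∫⁻ x, h x) ^ 2 ≤ 12 * (4 * ∫⁻ u, ∫⁻ x, ∑ j : Fin 4,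
      h (4 * x - 3 * cos ((j : ℕ) * (π / 2) - u - θ)) *
        h (4 * x - 3 * cos (((j + 1 : Fin 4) : ℕ) * (π / 2) - u - θ)) ∂volume ∂unif) := by
    rw [← lintegral_const_mul' 4 _ (by simp)]
    simp only [hleft]
    have hp : Function.Periodic (fun s => autocorr h (3 * (cos s + sin s))) (2 * π) :=
      fun s => by simp only [cos_add_two_pi, sin_add_two_pi]
    calc (∫⁻ x, h x) ^ 2 = ∫⁻ t in Icc (-2) 2, autocorr h t :=
          (setLIntegral_autocorr hm fun _ => hitProb_eq_zero).symm
      _ ≤ 6 * _ := setLIntegral_le_lintegral_cos_add_sin hK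
      _ ≤ 6 * (2 * _) := mul_le_mul_right (setLIntegral_period_le (by fun_prop) hp θ (-π)) _
      _ = _ := by rw [← mul_assoc]; norm_num
  calc 192 * (∫⁻ x, hitProb θ (n + 1) x) + (∫⁻ x, h x) ^ 2
      ≤ 192 * (∫⁻ x, hitProb θ (n + 1) x) + 12 * (4 * _) := by gcongr
    _ = 48 * (4 * (∫⁻ x, hitProb θ (n + 1) x) + _) := by ring
    _ ≤ 48 * _ := mul_le_mul_right hint _
    _ = 12 * (16 * ∫⁻ x, h x) := by
        rw [← hR]
        ring
    _ = 192 * ∫⁻ x, h x := by rw [← mul_assoc]; norm_num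

/-- A nonnegative sequence with a quadratic decrement decays like `1 / n`. -/
theorem mul_le_of_quadratic_decrement {a : ℕ → ℝ} {c : ℝ} (hc : 0 < c) (ha : ∀ n, 0 ≤ a n)
    (h : ∀ n, c * a (n + 1) + a n ^ 2 ≤ c * a n) (n : ℕ) : n * a n ≤ c := by
  induction n with
  | zero => simpa using hc.le
  | succ n ih =>
    have h1 : a n ≤ c := by
      by_contra! hlt
      nlinarith [h n, mul_nonneg hc.le (ha (n + 1))]
    have h2 : (n + 1) * (c * a (n + 1)) ≤ (n + 1) * (c * a n - a n ^ 2) := by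
      have := h n
      gcongr
      linarith
    push_cast
    refine le_of_mul_le_mul_left ?_ hc
    nlinarith [mul_nonneg (sub_nonneg.2 ih) (sub_nonneg.2 h1), sq_nonneg (a n)]

theorem integral_projLen_le (θ : ℝ) (n : ℕ) :
    ∫ ω, projLen θ (cantorDisks ω) ∂treeMeasure n ≤ (∫⁻ x, hitProb θ n x).toReal := by
  unfold projLen
  by_cases hi : Integrable (fun ω : AngleTree n => (volume (proj θ (cantorDisks ω))).toReal)
      (treeMeasure n)
  · rw [integral_eq_lintegral_of_nonneg_ae (.of_forall fun _ => ENNReal.toReal_nonneg)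
      hi.aestronglyMeasurable, ← lintegral_volume_proj]
    refine ENNReal.toReal_mono ?_ (lintegral_mono fun ω => ENNReal.ofReal_toReal_le)
    rw [lintegral_volume_proj]
    exact ne_top_of_le_ne_top (by simp) (lintegral_hitProb_le_two θ n)
  · rw [integral_undef hi]
    exact ENNReal.toReal_nonneg

/-- There is a constant `c > 0` such that for every `n ≥ 1` and every `θ ∈ [0, π)`,
the expected projection length of the `n`-th generation random Cantor disks is at
most `c / n`. -/
theorem expected_projection_length_le :
    ∃ c : ℝ, 0 < c ∧ ∀ n : ℕ, 1 ≤ n → ∀ θ ∈ Set.Ico (0 : ℝ) π,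
      (∫ ω, projLen θ (cantorDisks ω) ∂(treeMeasure n)) ≤ c / n := by
  refine ⟨192, by norm_num, fun n hn θ _ => (integral_projLen_le θ n).trans ?_⟩
  have hn' : (0 : ℝ) < n := by exact_mod_cast hn
  rw [le_div_iff₀ hn', mul_comm]
  refine mul_le_of_quadratic_decrement (a := fun n => (∫⁻ x, hitProb θ n x).toReal)
    (by norm_num) (fun _ => ENNReal.toReal_nonneg) (fun n => ?_) n
  have hfin (n : ℕ) : ∫⁻ x, hitProb θ n x ≠ ∞ :=
    ne_top_of_le_ne_top (by simp) (lintegral_hitProb_le_two θ n)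
  have hfin' (n : ℕ) : 192 * ∫⁻ x, hitProb θ n x ≠ ∞ := ENNReal.mul_ne_top (by simp) (hfin n)
  have h := ENNReal.toReal_mono (hfin' n) (lintegral_hitProb_recursion θ n)
  rwa [ENNReal.toReal_add (hfin' _) (ENNReal.pow_ne_top (hfin n)), ENNReal.toReal_mul,
    ENNReal.toReal_mul, ENNReal.toReal_pow, ENNReal.toReal_ofNat] at h

end
end

section
/- There exists a constant c > 0 such that for every n ≥ 1, the expected Favard length of the n-th generation random Cantor disks satisfies 𝔼[Fav(𝒟_n(ω))] ≤ c/n, where the expectation is over the i.i.d. uniform angle tree of height n. -/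
open MeasureTheory Real Set

noncomputable section

/-- The Favard length of a planar set: `Fav(E) = (1/π) ∫_0^π |proj_θ E| dθ`. -/
def favLength (E : Set ℂ) : ℝ := (1 / π) * ∫ θ in (0 : ℝ)..π, projLen θ E

open scoped ENNReal

/-- The probability that all four sub-intervals obtained by splitting with angle `β` avoid `y`,
when each of them is avoided with the probability prescribed by `g` at the rescaled position. -/
def splitProd (g : ℝ → ℝ≥0∞) (y β : ℝ) : ℝ≥0∞ :=
  ∏ j : Fin 4, g (4 * y - 3 * cos ((j : ℕ) * (π / 2) - β))

/-- The average of `splitProd` over a uniform angle. -/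
def splitAvg (g : ℝ → ℝ≥0∞) (y : ℝ) : ℝ≥0∞ :=
  (ENNReal.ofReal π)⁻¹ * ∫⁻ β in Ioc 0 π, splitProd g y β

lemma measurable_splitProd {g : ℝ → ℝ≥0∞} (hg : Measurable g) :
    Measurable (fun p : ℝ × ℝ => splitProd g p.1 p.2) := by
  unfold splitProd
  refine Finset.measurable_fun_prod _ fun j _ => hg.comp (by fun_prop)

lemma measurable_splitAvg {g : ℝ → ℝ≥0∞} (hg : Measurable g) : Measurable (splitAvg g) :=
  (measurable_splitProd hg).lintegral_prod_right'.const_mul _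

lemma splitProd_le_one {g : ℝ → ℝ≥0∞} (hg : ∀ x, g x ≤ 1) (y β : ℝ) : splitProd g y β ≤ 1 :=
  Finset.prod_le_one' fun _ _ => hg _

lemma ofReal_pi_inv_mul_volume : (ENNReal.ofReal π)⁻¹ * volume (Ioc 0 π) = 1 := by
  rw [Real.volume_Ioc, sub_zero]
  exact ENNReal.inv_mul_cancel (by simpa using pi_pos) ENNReal.ofReal_ne_top

lemma splitAvg_le_one {g : ℝ → ℝ≥0∞} (hg : ∀ x, g x ≤ 1) (y : ℝ) : splitAvg g y ≤ 1 := by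
  calc splitAvg g y ≤ (ENNReal.ofReal π)⁻¹ * ∫⁻ _ in Ioc 0 π, 1 := by
        unfold splitAvg; gcongr; exact splitProd_le_one hg _ _
    _ = 1 := by rw [setLIntegral_one, ofReal_pi_inv_mul_volume]

lemma splitAvg_eq_one {g : ℝ → ℝ≥0∞} (hg : ∀ x, 1 < |x| → g x = 1) {y : ℝ} (hy : 1 < |y|) :
    splitAvg g y = 1 := by
  have h : ∀ β, splitProd g y β = 1 := fun β => Finset.prod_eq_one fun j _ => hg _ <| by
    have h1 := abs_cos_le_one ((j : ℕ) * (π / 2) - β)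
    have h2 := abs_sub_abs_le_abs_sub (4 * y) (3 * cos ((j : ℕ) * (π / 2) - β))
    rw [abs_mul, abs_mul, abs_of_pos (by norm_num : (0 : ℝ) < 4),
      abs_of_pos (by norm_num : (0 : ℝ) < 3)] at h2
    linarith
  simp only [splitAvg, h, setLIntegral_one, ofReal_pi_inv_mul_volume]

lemma splitProd_periodic (g : ℝ → ℝ≥0∞) (y : ℝ) :
    Function.Periodic (splitProd g y) (π / 2) := by
  intro β
  have h : cos (0 * (π / 2) - (β + π / 2)) = cos (3 * (π / 2) - β) := by
    rw [← cos_add_two_pi]; congr 1; ring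
  simp only [splitProd, Fin.prod_univ_four, Fin.val_zero, Fin.val_one, Fin.val_two, Nat.cast_zero,
    Nat.cast_one, Nat.cast_ofNat, show ((3 : Fin 4) : ℕ) = 3 from rfl, h]
  rw [show 1 * (π / 2) - (β + π / 2) = 0 * (π / 2) - β by ring,
    show 2 * (π / 2) - (β + π / 2) = 1 * (π / 2) - β by ring,
    show 3 * (π / 2) - (β + π / 2) = 2 * (π / 2) - β by ring]
  ring

lemma Function.Periodic.setLIntegral_Ioc_eq {f : ℝ → ℝ≥0∞} {T : ℝ}
    (hf : Function.Periodic f T) (hT : 0 < T) (a b : ℝ) :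
    ∫⁻ x in Ioc a (a + T), f x = ∫⁻ x in Ioc b (b + T), f x := by
  refine (isAddFundamentalDomain_Ioc hT a).setLIntegral_eq (isAddFundamentalDomain_Ioc hT b) f ?_
  exact hf.map_vadd_zmultiples

lemma lintegral_unif_splitProd (g : ℝ → ℝ≥0∞) (y θ : ℝ) :
    ∫⁻ α, splitProd g y (α + θ) ∂unif = splitAvg g y := by
  have hT : 0 < π / 2 := by positivity
  have h1 : ∫⁻ α in Icc 0 (π / 2), splitProd g y (α + θ)
      = ∫⁻ β in Ioc 0 (0 + π / 2), splitProd g y β := by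
    rw [Measure.restrict_congr_set Ioc_ae_eq_Icc.symm,
      ← (splitProd_periodic g y).setLIntegral_Ioc_eq hT θ 0,
      ← (measurePreserving_add_right volume θ).setLIntegral_comp_preimage_emb
        (measurableEmbedding_addRight θ) (splitProd g y), preimage_add_const_Ioc, sub_self,
      add_sub_cancel_left]
  have h2 : ∫⁻ β in Ioc 0 π, splitProd g y β
      = 2 * ∫⁻ β in Ioc 0 (0 + π / 2), splitProd g y β := by
    rw [show Ioc 0 π = Ioc 0 (0 + π / 2) ∪ Ioc (π / 2) (π / 2 + π / 2) by
        rw [zero_add, Ioc_union_Ioc_eq_Ioc hT.le (by linarith)]; congr 1; ring,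
      lintegral_union measurableSet_Ioc (by rw [zero_add]; exact Ioc_disjoint_Ioc_of_le le_rfl),
      (splitProd_periodic g y).setLIntegral_Ioc_eq hT (π / 2) 0, two_mul]
  rw [unif, lintegral_smul_measure, splitAvg, h1, h2, smul_eq_mul, ← mul_assoc]
  congr 1
  rw [ENNReal.ofReal_div_of_pos two_pos, ENNReal.inv_div (by simp) (by simp), ENNReal.ofReal_ofNat,
    ENNReal.div_eq_inv_mul]

lemma lintegral_comp_four_mul_sub {f : ℝ → ℝ≥0∞} (hf : Measurable f) (b : ℝ) :
    ∫⁻ y, f (4 * y - b) = 4⁻¹ * ∫⁻ y, f y := by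
  have h : ∫⁻ y, f (4 * y - b) = ∫⁻ x, f (x - b) ∂(volume.map (fun y : ℝ => 4 * y)) :=
    (lintegral_map (f := fun x => f (x - b)) (hf.comp (by fun_prop)) (by fun_prop)).symm
  rw [h, Real.map_volume_mul_left (by norm_num), lintegral_smul_measure,
    lintegral_sub_right_eq_self f b, abs_of_pos (by norm_num),
    ENNReal.ofReal_inv_of_pos (by norm_num)]
  simp

/-- A union bound for four independent events that keeps one of the pairwise corrections. -/
lemma one_sub_prod_add_le {a b c d : ℝ≥0∞} (ha : a ≤ 1) (hb : b ≤ 1) (hc : c ≤ 1) (hd : d ≤ 1) :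
    1 - a * b * c * d + (1 - a) * (1 - c) ≤ (1 - a) + (1 - b) + (1 - c) + (1 - d) := by
  lift a to NNReal using ne_top_of_le_ne_top ENNReal.one_ne_top ha
  lift b to NNReal using ne_top_of_le_ne_top ENNReal.one_ne_top hb
  lift c to NNReal using ne_top_of_le_ne_top ENNReal.one_ne_top hc
  lift d to NNReal using ne_top_of_le_ne_top ENNReal.one_ne_top hd
  norm_cast at *
  have h : a * b * c * d ≤ 1 :=
    mul_le_one' (mul_le_one' (mul_le_one' ha hb) hc) hd
  rw [← NNReal.coe_le_coe]
  push_cast [NNReal.coe_sub, ha, hb, hc, hd, h]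
  rw [← NNReal.coe_le_coe, NNReal.coe_one] at ha hb hc hd
  have hac : (a * c : ℝ) ≤ 1 := mul_le_one₀ ha c.coe_nonneg hc
  have hbd : (b * d : ℝ) ≤ 1 := mul_le_one₀ hb d.coe_nonneg hd
  nlinarith [mul_nonneg (sub_nonneg.2 hac) (sub_nonneg.2 hbd),
    mul_nonneg (sub_nonneg.2 hb) (sub_nonneg.2 hd)]

lemma sq_lintegral_le_lintegral_cos {f : ℝ → ℝ≥0∞} (hf : Measurable f)
    (hf0 : ∀ x, 1 < |x| → f x = 0) :
    6⁻¹ * (∫⁻ x, f x) ^ 2 ≤ ∫⁻ β in Ioc 0 π, ∫⁻ x, f x * f (x + 6 * cos β) := by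
  set F : ℝ → ℝ≥0∞ := fun s => ∫⁻ x, f x * f (x + s) with hF
  have hFint : ∫⁻ s, F s = (∫⁻ x, f x) ^ 2 := by
    rw [hF, lintegral_lintegral_swap (by fun_prop)]
    have h : ∀ x, ∫⁻ s, f x * f (x + s) = f x * ∫⁻ s, f s := fun x => by
      rw [lintegral_const_mul _ (by fun_prop), lintegral_add_left_eq_self f x]
    simp_rw [h]
    rw [lintegral_mul_const _ hf, sq]
  have hFsupp : ∀ s, s ∉ (fun β => 6 * cos β) '' Icc 0 π → F s = 0 := by
    intro s hs
    have hs6 : 6 < |s| := by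
      by_contra! hle
      have hmem : s / 6 ∈ Icc (-1 : ℝ) 1 := by
        rw [abs_le] at hle; constructor <;> linarith
      obtain ⟨β, hβ, hcos⟩ := bijOn_cos.surjOn hmem
      exact hs ⟨β, hβ, by simp only [hcos]; ring⟩
    refine (lintegral_congr fun x => ?_).trans lintegral_zero
    by_cases hx : 1 < |x|
    · simp [hf0 x hx]
    · rw [hf0 (x + s), mul_zero]
      have := abs_sub_abs_le_abs_sub s (-x)
      rw [abs_neg, sub_neg_eq_add, add_comm s x] at this
      linarith
  have himage := lintegral_image_eq_lintegral_abs_deriv_mul (s := Icc 0 π)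
    (f := fun β => 6 * cos β) (f' := fun β => 6 * -sin β) measurableSet_Icc
    (fun β _ => ((hasDerivAt_cos β).const_mul 6).hasDerivWithinAt)
    (fun a ha b hb hab => injOn_cos ha hb (by simpa using hab)) F
  rw [setLIntegral_eq_of_support_subset
    (fun x hx => by_contra fun h => hx (hFsupp x h)), hFint] at himage
  rw [himage, Measure.restrict_congr_set Ioc_ae_eq_Icc, ← lintegral_const_mul' _ _ (by simp)]
  refine lintegral_mono fun β => ?_
  rw [← mul_assoc]
  refine mul_le_of_le_one_left' ?_
  have h6 : ENNReal.ofReal |6 * -sin β| ≤ 6 := by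
    rw [← ENNReal.ofReal_ofNat 6]
    refine ENNReal.ofReal_le_ofReal ?_
    rw [abs_mul, abs_neg, abs_of_pos (by norm_num : (0 : ℝ) < 6)]
    linarith [abs_sin_le_one β]
  calc (6⁻¹ : ℝ≥0∞) * ENNReal.ofReal |6 * -sin β| ≤ 6⁻¹ * 6 := by gcongr
    _ = 1 := ENNReal.inv_mul_cancel (by simp) (by simp)

lemma lintegral_one_sub_splitAvg_add_le {g : ℝ → ℝ≥0∞} (hg : Measurable g) (hg1 : ∀ x, g x ≤ 1)
    (hg0 : ∀ x, 1 < |x| → g x = 1) :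
    (∫⁻ y, (1 - splitAvg g y)) + (ENNReal.ofReal (24 * π))⁻¹ * (∫⁻ y, (1 - g y)) ^ 2
      ≤ ∫⁻ y, (1 - g y) := by
  set f : ℝ → ℝ≥0∞ := fun y => 1 - g y with hf_def
  have hf : Measurable f := measurable_const.sub hg
  have hf0 : ∀ x, 1 < |x| → f x = 0 := fun x hx => by simp [hf_def, hg0 x hx]
  set ν : Measure ℝ := (ENNReal.ofReal π)⁻¹ • volume.restrict (Ioc 0 π) with hν
  have hν1 : ν univ = 1 := by simpa [hν] using ofReal_pi_inv_mul_volume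
  have : IsProbabilityMeasure ν := ⟨hν1⟩
  have hK : Measurable (fun p : ℝ × ℝ => splitProd g p.1 p.2) := measurable_splitProd hg
  have hsub : ∀ y, 1 - splitAvg g y ≤ ∫⁻ β, (1 - splitProd g y β) ∂ν := fun y => by
    calc 1 - splitAvg g y = ∫⁻ _, 1 ∂ν - ∫⁻ β, splitProd g y β ∂ν := by
          rw [lintegral_one, hν1, hν, lintegral_smul_measure, smul_eq_mul, splitAvg]
      _ ≤ _ := lintegral_sub_le _ _ (hK.comp measurable_prodMk_left)
  have hpair : (ENNReal.ofReal (24 * π))⁻¹ * (∫⁻ y, f y) ^ 2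
      ≤ ∫⁻ y, ∫⁻ β, f (4 * y - 3 * cos β) * f (4 * y + 3 * cos β) ∂ν := by
    rw [lintegral_lintegral_swap (by fun_prop)]
    have h : ∀ β, ∫⁻ y, f (4 * y - 3 * cos β) * f (4 * y + 3 * cos β)
        = 4⁻¹ * ∫⁻ x, f x * f (x + 6 * cos β) := fun β => by
      rw [← lintegral_comp_four_mul_sub (f := fun x => f x * f (x + 6 * cos β)) (by fun_prop)
        (3 * cos β)]
      refine lintegral_congr fun y => ?_
      congr 2; ring
    simp_rw [h]
    rw [lintegral_const_mul' _ _ (by simp), hν, lintegral_smul_measure, smul_eq_mul]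
    calc (ENNReal.ofReal (24 * π))⁻¹ * (∫⁻ y, f y) ^ 2
        = 4⁻¹ * ((ENNReal.ofReal π)⁻¹ * (6⁻¹ * (∫⁻ y, f y) ^ 2)) := by
          rw [← mul_assoc, ← mul_assoc, ENNReal.ofReal_mul (by norm_num), ENNReal.ofReal_ofNat,
            ENNReal.mul_inv (by simp) (by simp)]
          congr 1
          rw [mul_right_comm, ← ENNReal.mul_inv (a := 4) (by simp) (by simp)]
          norm_num
      _ ≤ _ := by gcongr; exact sq_lintegral_le_lintegral_cos hf hf0
  have hpoint : ∀ y β, (1 - splitProd g y β) + f (4 * y - 3 * cos β) * f (4 * y + 3 * cos β)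
      ≤ ∑ j : Fin 4, f (4 * y - 3 * cos ((j : ℕ) * (π / 2) - β)) := fun y β => by
    have h0 : 4 * y - 3 * cos β = 4 * y - 3 * cos (0 * (π / 2) - β) := by
      rw [zero_mul, zero_sub, cos_neg]
    have h2 : 4 * y + 3 * cos β = 4 * y - 3 * cos (2 * (π / 2) - β) := by
      rw [mul_div_cancel₀ _ two_ne_zero, cos_pi_sub]; ring
    rw [h0, h2, Fin.sum_univ_four, splitProd, Fin.prod_univ_four]
    simpa using one_sub_prod_add_le (hg1 _) (hg1 _) (hg1 _) (hg1 _)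
  have hsum : ∫⁻ y, ∫⁻ β, ∑ j : Fin 4, f (4 * y - 3 * cos ((j : ℕ) * (π / 2) - β)) ∂ν
      = ∫⁻ y, f y := by
    rw [lintegral_lintegral_swap (by fun_prop)]
    have h : ∀ β : ℝ, ∫⁻ y, ∑ j : Fin 4, f (4 * y - 3 * cos ((j : ℕ) * (π / 2) - β))
        = ∫⁻ y, f y := fun β => by
      rw [lintegral_finsetSum _ (fun j _ => by fun_prop)]
      simp_rw [lintegral_comp_four_mul_sub hf]
      rw [Finset.sum_const, Finset.card_univ, Fintype.card_fin, nsmul_eq_mul, ← mul_assoc]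
      rw [Nat.cast_ofNat, ENNReal.mul_inv_cancel (by simp) (by simp), one_mul]
    simp_rw [h]
    rw [lintegral_const, hν1, mul_one]
  calc (∫⁻ y, (1 - splitAvg g y)) + (ENNReal.ofReal (24 * π))⁻¹ * (∫⁻ y, f y) ^ 2
      ≤ (∫⁻ y, ∫⁻ β, (1 - splitProd g y β) ∂ν)
        + ∫⁻ y, ∫⁻ β, f (4 * y - 3 * cos β) * f (4 * y + 3 * cos β) ∂ν :=
        add_le_add (lintegral_mono hsub) hpair
    _ = ∫⁻ y, ∫⁻ β, ((1 - splitProd g y β)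
        + f (4 * y - 3 * cos β) * f (4 * y + 3 * cos β)) ∂ν := by
      have hm : Measurable (fun p : ℝ × ℝ => 1 - splitProd g p.1 p.2) := measurable_const.sub hK
      rw [← lintegral_add_left hm.lintegral_prod_right']
      refine lintegral_congr fun y => (lintegral_add_left ?_ _).symm
      exact hm.comp measurable_prodMk_left
    _ ≤ ∫⁻ y, ∫⁻ β, ∑ j : Fin 4, f (4 * y - 3 * cos ((j : ℕ) * (π / 2) - β)) ∂ν :=
      lintegral_mono fun y => lintegral_mono fun β => hpoint y β
    _ = ∫⁻ y, f y := hsum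

/-- The function equal to `0` on `[-1, 1]` and to `1` elsewhere. -/
def outsideUnit : ℝ → ℝ≥0∞ := (Icc (-1) 1)ᶜ.indicator 1

lemma splitAvg_iterate_props (n : ℕ) :
    Measurable (splitAvg^[n] outsideUnit) ∧ (∀ x, splitAvg^[n] outsideUnit x ≤ 1) ∧
      ∀ x, 1 < |x| → splitAvg^[n] outsideUnit x = 1 := by
  induction n with
  | zero =>
    refine ⟨measurable_one.indicator measurableSet_Icc.compl,
      fun x => indicator_apply_le' (fun _ => le_rfl) (fun _ => zero_le), fun x hx => ?_⟩
    refine indicator_of_mem (fun h => ?_) _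
    exact hx.not_ge (abs_le.2 h)
  | succ n ih =>
    rw [Function.iterate_succ_apply']
    exact ⟨measurable_splitAvg ih.1, splitAvg_le_one ih.2.1, fun x hx => splitAvg_eq_one ih.2.2 hx⟩

lemma lintegral_one_sub_outsideUnit : ∫⁻ y, (1 - outsideUnit y) = 2 := by
  have h : (fun y => 1 - outsideUnit y) = (Icc (-1) 1).indicator 1 := by
    ext y
    by_cases hy : y ∈ Icc (-1 : ℝ) 1 <;> simp only [outsideUnit, indicator, mem_compl_iff, hy] <;>
      simp
  rw [h, lintegral_indicator_one measurableSet_Icc, Real.volume_Icc]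
  norm_num

lemma lintegral_one_sub_splitAvg_iterate_le (n : ℕ) :
    ∫⁻ y, (1 - splitAvg^[n] outsideUnit y) ≤ ENNReal.ofReal (24 * π / (n + 2)) := by
  have hK : (0 : ℝ) < 24 * π := by positivity
  induction n with
  | zero =>
    rw [Function.iterate_zero_apply, lintegral_one_sub_outsideUnit, ← ENNReal.ofReal_ofNat]
    refine ENNReal.ofReal_le_ofReal ?_
    push_cast
    linarith [pi_gt_three]
  | succ n ih =>
    obtain ⟨h1, h2, h3⟩ := splitAvg_iterate_props n
    have hrec := lintegral_one_sub_splitAvg_add_le h1 h2 h3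
    rw [Function.iterate_succ_apply']
    set A := ∫⁻ y, (1 - splitAvg^[n] outsideUnit y)
    set B := ∫⁻ y, (1 - splitAvg (splitAvg^[n] outsideUnit) y)
    have hA : A ≠ ∞ := ne_top_of_le_ne_top ENNReal.ofReal_ne_top ih
    have hB : B ≠ ∞ := ne_top_of_le_ne_top hA (le_self_add.trans hrec)
    have hr : B.toReal + (24 * π)⁻¹ * A.toReal ^ 2 ≤ A.toReal := by
      have := ENNReal.toReal_mono hA hrec
      rwa [ENNReal.toReal_add hB (ne_top_of_le_ne_top hA (le_add_self.trans hrec)),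
        ENNReal.toReal_mul, ENNReal.toReal_inv, ENNReal.toReal_ofReal hK.le,
        ENNReal.toReal_pow] at this
    have ihr : A.toReal ≤ 24 * π / (n + 2) :=
      ENNReal.toReal_le_of_le_ofReal (by positivity) ih
    rw [← ENNReal.ofReal_toReal hB]
    refine ENNReal.ofReal_le_ofReal ?_
    have ha0 : 0 ≤ A.toReal := ENNReal.toReal_nonneg
    generalize A.toReal = a at *
    generalize B.toReal = b at *
    generalize 24 * π = K at *
    have hn : (0 : ℝ) ≤ n := n.cast_nonneg
    have hmono : a - K⁻¹ * a ^ 2 ≤ K / (n + 2) - K⁻¹ * (K / (n + 2)) ^ 2 := by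
      have hx : K / (n + 2) ≤ K / 2 := by gcongr; linarith
      have : 0 ≤ K⁻¹ * ((K / (n + 2) - a) * (K - (K / (n + 2) + a))) := by
        refine mul_nonneg (by positivity) (mul_nonneg (by linarith) (by linarith))
      have e : K⁻¹ * ((K / (n + 2) - a) * (K - (K / (n + 2) + a)))
        = (K⁻¹ * K) * (K / (n + 2) - a) - K⁻¹ * (K / (n + 2)) ^ 2 + K⁻¹ * a ^ 2 := by ring
      rw [e, inv_mul_cancel₀ hK.ne'] at this
      linarith
    have hfin : K / (n + 2) - K⁻¹ * (K / (n + 2)) ^ 2 ≤ K / ((n + 1 : ℕ) + 2) := by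
      push_cast
      rw [show K / (n + 2) - K⁻¹ * (K / (n + 2)) ^ 2 = K * (n + 1) / (n + 2) ^ 2 by
        field_simp; ring, div_le_div_iff₀ (by positivity) (by positivity), mul_assoc]
      gcongr
      nlinarith
    linarith

instance : IsProbabilityMeasure unif := by
  refine ⟨?_⟩
  rw [unif, Measure.smul_apply, Measure.restrict_apply_univ, Real.volume_Icc, sub_zero,
    smul_eq_mul]
  exact ENNReal.inv_mul_cancel (by simpa using pi_pos) ENNReal.ofReal_ne_top

instance (n : ℕ) : IsProbabilityMeasure (treeMeasure n) := by
  unfold treeMeasure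
  infer_instance

/-- Extend an angle tree by one generation. -/
def AngleTree.snoc {n : ℕ} (ω : AngleTree n) (η : (Fin n → Fin 4) → ℝ) : AngleTree (n + 1) :=
  Fin.snoc (α := fun k : Fin (n + 1) => (Fin k → Fin 4) → ℝ) ω η

lemma AngleTree.snoc_castSucc {n : ℕ} (ω : AngleTree n) (η : (Fin n → Fin 4) → ℝ) (k : Fin n) :
    ω.snoc η k.castSucc = ω k :=
  Fin.snoc_castSucc (α := fun k : Fin (n + 1) => (Fin k → Fin 4) → ℝ) η ω k

lemma AngleTree.snoc_last {n : ℕ} (ω : AngleTree n) (η : (Fin n → Fin 4) → ℝ) :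
    ω.snoc η (Fin.last n) = η :=
  Fin.snoc_last (α := fun k : Fin (n + 1) => (Fin k → Fin 4) → ℝ) η ω

lemma AngleTree.measurable_snoc (n : ℕ) :
    Measurable (fun p : AngleTree n × ((Fin n → Fin 4) → ℝ) => p.1.snoc p.2) := by
  refine measurable_pi_iff.2 fun k => ?_
  induction k using Fin.lastCases with
  | last =>
    simp_rw [AngleTree.snoc_last]
    exact measurable_snd
  | cast k =>
    simp_rw [AngleTree.snoc_castSucc]
    exact (measurable_pi_apply k).comp measurable_fst

lemma treeMeasure_succ (n : ℕ) :
    treeMeasure (n + 1) =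
      ((treeMeasure n).prod (Measure.pi fun _ : Fin n → Fin 4 => unif)).map
        (fun p => p.1.snoc p.2) := by
  refine Measure.pi_eq fun s hs => ?_
  rw [Measure.map_apply (AngleTree.measurable_snoc n) (MeasurableSet.univ_pi hs)]
  have hpre : (fun p : AngleTree n × ((Fin n → Fin 4) → ℝ) => p.1.snoc p.2) ⁻¹' univ.pi s
      = (univ.pi fun k : Fin n => s k.castSucc) ×ˢ s (Fin.last n) := by
    ext p
    simp only [mem_preimage, mem_univ_pi, mem_prod, Fin.forall_fin_succ']
    rw [AngleTree.snoc_last]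
    simp_rw [AngleTree.snoc_castSucc]
  rw [hpre, Measure.prod_prod, Fin.prod_univ_castSucc, treeMeasure, Measure.pi_pi]
  rfl

lemma re_exp_mul_center {n : ℕ} (θ : ℝ) (ω : AngleTree n) (w : Fin n → Fin 4) :
    (Complex.exp (-(θ : ℂ) * Complex.I) * center ω w).re =
      ∑ k : Fin n, 3 / 4 * (4 : ℝ)⁻¹ ^ (k : ℕ) *
        cos ((w k : ℕ) * (π / 2) - (ω k (fun i => w (Fin.castLE k.isLt.le i)) + θ)) := by
  rw [_root_.center, Finset.mul_sum, Complex.re_sum]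
  refine Finset.sum_congr rfl fun k _ => ?_
  rw [mul_left_comm, ← Complex.exp_add, ← add_mul, ← Complex.ofReal_neg, ← Complex.ofReal_add,
    show (3 / 4 : ℂ) * (4 : ℂ)⁻¹ ^ (k : ℕ) = ((3 / 4 * (4 : ℝ)⁻¹ ^ (k : ℕ) : ℝ) : ℂ) by
      push_cast; rfl, Complex.re_ofReal_mul, Complex.exp_ofReal_mul_I_re]
  congr 2
  ring

/-- Position of `x` relative to the projection in direction `θ` of the disk indexed by `w`,
rescaled so that this projection becomes `[-1, 1]`. -/
def relPos {n : ℕ} (θ x : ℝ) (ω : AngleTree n) (w : Fin n → Fin 4) : ℝ :=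
  4 ^ n * (x - (Complex.exp (-(θ : ℂ) * Complex.I) * center ω w).re)

lemma relPos_snoc {n : ℕ} (θ x : ℝ) (ω : AngleTree n) (η : (Fin n → Fin 4) → ℝ)
    (v : Fin n → Fin 4) (j : Fin 4) :
    relPos θ x (ω.snoc η) (Fin.snoc (α := fun _ => Fin 4) v j) =
      4 * relPos θ x ω v - 3 * cos ((j : ℕ) * (π / 2) - (η v + θ)) := by
  have hv : ∀ (k : Fin n) (i : Fin k),
      (Fin.snoc (α := fun _ => Fin 4) v j : Fin (n + 1) → Fin 4)
        (Fin.castLE k.castSucc.isLt.le i) = v (Fin.castLE k.isLt.le i) := fun k i =>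
    Fin.snoc_castSucc (α := fun _ => Fin 4) j v (Fin.castLE k.isLt.le i)
  have hl : ∀ i : Fin n,
      (Fin.snoc (α := fun _ => Fin 4) v j : Fin (n + 1) → Fin 4)
        (Fin.castLE (Fin.last n).isLt.le i) = v i := fun i =>
    Fin.snoc_castSucc (α := fun _ => Fin 4) j v i
  have h4 : (4 : ℝ) ^ n * 4⁻¹ ^ n = 1 := by rw [← mul_pow]; norm_num
  rw [relPos, relPos, re_exp_mul_center, re_exp_mul_center, Fin.sum_univ_castSucc]
  have hlast : ω.snoc η (Fin.last n) (fun i => (Fin.snoc (α := fun _ => Fin 4) v j :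
      Fin (n + 1) → Fin 4) (Fin.castLE (Fin.last n).isLt.le i)) = η v := by
    rw [AngleTree.snoc_last]; exact congrArg η (funext hl)
  have hcast : ∀ k : Fin n, ω.snoc η k.castSucc (fun i => (Fin.snoc (α := fun _ => Fin 4) v j :
      Fin (n + 1) → Fin 4) (Fin.castLE k.castSucc.isLt.le i))
      = ω k (fun i => v (Fin.castLE k.isLt.le i)) := fun k => by
    rw [AngleTree.snoc_castSucc]; exact congrArg (ω k) (funext (hv k))
  simp_rw [hcast]
  rw [hlast, Fin.snoc_last]
  simp_rw [Fin.snoc_castSucc, Fin.val_castSucc, Fin.val_last]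
  rw [pow_succ]
  linear_combination (-3 * cos ((j : ℕ) * (π / 2) - (η v + θ))) * h4

lemma continuous_relPos {n : ℕ} (w : Fin n → Fin 4) :
    Continuous (fun p : (ℝ × ℝ) × AngleTree n => relPos p.1.1 p.1.2 p.2 w) := by
  unfold relPos
  simp_rw [re_exp_mul_center]
  fun_prop

lemma measurable_prod_relPos {n : ℕ} {g : ℝ → ℝ≥0∞} (hg : Measurable g) :
    Measurable (fun p : (ℝ × ℝ) × AngleTree n =>
      ∏ w : Fin n → Fin 4, g (relPos p.1.1 p.1.2 p.2 w)) :=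
  Finset.measurable_fun_prod _ fun w _ => hg.comp (continuous_relPos w).measurable

lemma lintegral_prod_relPos_succ (n : ℕ) {g : ℝ → ℝ≥0∞} (hg : Measurable g) (θ x : ℝ) :
    ∫⁻ ω, ∏ w : Fin (n + 1) → Fin 4, g (relPos θ x ω w) ∂(treeMeasure (n + 1))
      = ∫⁻ ω, ∏ v : Fin n → Fin 4, splitAvg g (relPos θ x ω v) ∂(treeMeasure n) := by
  have hm : Measurable (fun ω : AngleTree (n + 1) =>
      ∏ w : Fin (n + 1) → Fin 4, g (relPos θ x ω w)) :=
    (measurable_prod_relPos hg).comp (measurable_prodMk_left (x := (θ, x)))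
  have hm2 : Measurable fun p : AngleTree n × ((Fin n → Fin 4) → ℝ) =>
      ∏ w : Fin (n + 1) → Fin 4, g (relPos θ x (p.1.snoc p.2) w) :=
    hm.comp (AngleTree.measurable_snoc n)
  rw [treeMeasure_succ, lintegral_map hm (AngleTree.measurable_snoc n),
    lintegral_prod _ hm2.aemeasurable]
  refine lintegral_congr fun ω => ?_
  have hfactor : ∀ η : (Fin n → Fin 4) → ℝ,
      ∏ w : Fin (n + 1) → Fin 4, g (relPos θ x (ω.snoc η) w)
        = ∏ v : Fin n → Fin 4, splitProd g (relPos θ x ω v) (η v + θ) := fun η => by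
    rw [← (Fin.snocEquiv (fun _ : Fin (n + 1) => Fin 4)).prod_comp, Fintype.prod_prod_type_right]
    refine Finset.prod_congr rfl fun v _ => Finset.prod_congr rfl fun j _ => ?_
    exact congrArg g (relPos_snoc θ x ω η v j)
  have hmv : ∀ v : Fin n → Fin 4,
      Measurable fun α : ℝ => splitProd g (relPos θ x ω v) (α + θ) := fun v =>
    (measurable_splitProd hg).comp (by fun_prop : Measurable fun α : ℝ => (relPos θ x ω v, α + θ))
  simp_rw [hfactor]
  rw [ProbabilityTheory.lintegral_prod_eq_prod_lintegral_of_indepFun Finset.univ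
    (fun v (η : (Fin n → Fin 4) → ℝ) => splitProd g (relPos θ x ω v) (η v + θ))
    (ProbabilityTheory.iIndepFun_pi (μ := fun _ : Fin n → Fin 4 => unif)
      (X := fun v α => splitProd g (relPos θ x ω v) (α + θ)) fun v => (hmv v).aemeasurable)
    fun v => (hmv v).comp (measurable_pi_apply v)]
  refine Finset.prod_congr rfl fun v _ => ?_
  rw [(measurePreserving_eval (fun _ : Fin n → Fin 4 => unif) v).lintegral_comp (hmv v),
    lintegral_unif_splitProd]

lemma lintegral_prod_relPos (n : ℕ) {g : ℝ → ℝ≥0∞} (hg : Measurable g) (θ x : ℝ) :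
    ∫⁻ ω, ∏ w : Fin n → Fin 4, g (relPos θ x ω w) ∂(treeMeasure n) = splitAvg^[n] g x := by
  induction n generalizing g with
  | zero =>
    simp [relPos, _root_.center]
  | succ n ih =>
    rw [lintegral_prod_relPos_succ n hg, ih (measurable_splitAvg hg), Function.iterate_succ_apply]

lemma volume_proj_cantorDisks_le {n : ℕ} (θ : ℝ) (ω : AngleTree n) :
    volume (proj θ (cantorDisks ω))
      ≤ ∫⁻ x, (1 - ∏ w : Fin n → Fin 4, outsideUnit (relPos θ x ω w)) := by
  have hm : MeasurableSet {x | ∃ w, relPos θ x ω w ∈ Icc (-1 : ℝ) 1} := by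
    simp_rw [ofPred_exists]
    refine MeasurableSet.iUnion fun w => measurableSet_Icc.preimage ?_
    exact (continuous_relPos w).measurable.comp
      (by fun_prop : Measurable fun x : ℝ => ((θ, x), ω))
  have hsub : proj θ (cantorDisks ω) ⊆ {x | ∃ w, relPos θ x ω w ∈ Icc (-1 : ℝ) 1} := by
    rintro _ ⟨z, hz, rfl⟩
    obtain ⟨w, hw⟩ := mem_iUnion.1 hz
    refine ⟨w, abs_le.1 ?_⟩
    rw [mem_closedBall_iff_norm] at hw
    have h4 : (4 : ℝ) ^ n * 4⁻¹ ^ n = 1 := by rw [← mul_pow]; norm_num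
    rw [relPos, ← Complex.sub_re, ← mul_sub, abs_mul, abs_of_pos (by positivity), ← h4]
    gcongr
    refine (Complex.abs_re_le_norm _).trans ?_
    rwa [norm_mul, ← Complex.ofReal_neg, Complex.norm_exp_ofReal_mul_I, one_mul]
  calc volume (proj θ (cantorDisks ω))
      ≤ volume {x | ∃ w, relPos θ x ω w ∈ Icc (-1 : ℝ) 1} := measure_mono hsub
    _ = ∫⁻ x, {x | ∃ w, relPos θ x ω w ∈ Icc (-1 : ℝ) 1}.indicator 1 x :=
      (lintegral_indicator_one hm).symm
    _ ≤ _ := by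
      refine lintegral_mono (indicator_le fun x hx => ?_)
      obtain ⟨w, hw⟩ := hx
      have h0 : outsideUnit (relPos θ x ω w) = 0 := indicator_of_notMem (not_not.2 hw) _
      rw [Finset.prod_eq_zero (Finset.mem_univ w) h0, tsub_zero, Pi.one_apply]

lemma ofReal_integral_le_lintegral {α : Type*} [MeasurableSpace α] (μ : Measure α) {f : α → ℝ}
    (hf : ∀ x, 0 ≤ f x) : ENNReal.ofReal (∫ x, f x ∂μ) ≤ ∫⁻ x, ENNReal.ofReal (f x) ∂μ := by
  have h := enorm_integral_le_lintegral_enorm (μ := μ) f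
  rw [Real.enorm_eq_ofReal (integral_nonneg hf)] at h
  simpa only [Real.enorm_eq_ofReal (hf _)] using h

lemma favLength_nonneg (E : Set ℂ) : 0 ≤ favLength E :=
  mul_nonneg (by positivity)
    (intervalIntegral.integral_nonneg pi_pos.le fun _ _ => ENNReal.toReal_nonneg)

lemma ofReal_favLength_le (E : Set ℂ) :
    ENNReal.ofReal (favLength E) ≤ (ENNReal.ofReal π)⁻¹ * ∫⁻ θ in Ioc 0 π, volume (proj θ E) := by
  rw [favLength, intervalIntegral.integral_of_le pi_pos.le, ENNReal.ofReal_mul (by positivity),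
    one_div, ENNReal.ofReal_inv_of_pos pi_pos]
  gcongr
  refine (ofReal_integral_le_lintegral _ fun _ => ENNReal.toReal_nonneg).trans ?_
  exact lintegral_mono fun θ => ENNReal.ofReal_toReal_le

lemma lintegral_lintegral_one_sub_prod_relPos_le (n : ℕ) (θ : ℝ) :
    ∫⁻ ω, (∫⁻ x, (1 - ∏ w : Fin n → Fin 4, outsideUnit (relPos θ x ω w))) ∂(treeMeasure n)
      ≤ ENNReal.ofReal (24 * π / (n + 2)) := by
  have hg : Measurable outsideUnit := (splitAvg_iterate_props 0).1
  have hg1 : ∀ x, outsideUnit x ≤ 1 := (splitAvg_iterate_props 0).2.1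
  have hm := measurable_prod_relPos (n := n) hg
  rw [lintegral_lintegral_swap]
  · refine le_trans (le_of_eq (lintegral_congr fun x => ?_))
      (lintegral_one_sub_splitAvg_iterate_le n)
    have h1 : ∫⁻ ω, ∏ w : Fin n → Fin 4, outsideUnit (relPos θ x ω w) ∂(treeMeasure n) ≠ ∞ := by
      rw [lintegral_prod_relPos n hg]
      exact ne_top_of_le_ne_top ENNReal.one_ne_top ((splitAvg_iterate_props n).2.1 x)
    have hmx : Measurable fun ω : AngleTree n =>
        ∏ w : Fin n → Fin 4, outsideUnit (relPos θ x ω w) :=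
      hm.comp (measurable_prodMk_left (x := (θ, x)))
    rw [lintegral_sub hmx h1
      (Filter.Eventually.of_forall fun ω => Finset.prod_le_one' fun _ _ => hg1 _),
      lintegral_prod_relPos n hg, lintegral_one, measure_univ]
  · exact (measurable_const.sub (hm.comp
      (by fun_prop : Measurable fun p : AngleTree n × ℝ => ((θ, p.2), p.1)))).aemeasurable

lemma lintegral_favLength_le (n : ℕ) :
    ∫⁻ ω, ENNReal.ofReal (favLength (cantorDisks ω)) ∂(treeMeasure n)
      ≤ ENNReal.ofReal (24 * π / (n + 2)) := by
  have hg : Measurable outsideUnit := (splitAvg_iterate_props 0).1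
  have hm := measurable_prod_relPos (n := n) hg
  have hm' : Measurable fun p : AngleTree n × ℝ =>
      ∫⁻ x, (1 - ∏ w : Fin n → Fin 4, outsideUnit (relPos p.2 x p.1 w)) := by
    have hφ : Measurable fun q : (AngleTree n × ℝ) × ℝ => ((q.1.2, q.2), q.1.1) :=
      ((measurable_snd.comp measurable_fst).prodMk measurable_snd).prodMk
        (measurable_fst.comp measurable_fst)
    have hmq := measurable_const.sub (hm.comp hφ) (f := fun _ => (1 : ℝ≥0∞))
    exact hmq.lintegral_prod_right'
  calc ∫⁻ ω, ENNReal.ofReal (favLength (cantorDisks ω)) ∂(treeMeasure n)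
      ≤ ∫⁻ ω, ((ENNReal.ofReal π)⁻¹ * ∫⁻ θ in Ioc 0 π, ∫⁻ x,
          (1 - ∏ w : Fin n → Fin 4, outsideUnit (relPos θ x ω w))) ∂(treeMeasure n) := by
        refine lintegral_mono fun ω => (ofReal_favLength_le _).trans ?_
        gcongr
        exact volume_proj_cantorDisks_le _ ω
    _ = (ENNReal.ofReal π)⁻¹ * ∫⁻ θ in Ioc 0 π, ∫⁻ ω, (∫⁻ x,
          (1 - ∏ w : Fin n → Fin 4, outsideUnit (relPos θ x ω w))) ∂(treeMeasure n) := by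
        rw [lintegral_const_mul' _ _ (by simpa using pi_pos),
          lintegral_lintegral_swap hm'.aemeasurable]
    _ ≤ (ENNReal.ofReal π)⁻¹ * ∫⁻ _ in Ioc 0 π, ENNReal.ofReal (24 * π / (n + 2)) := by
        gcongr
        exact lintegral_lintegral_one_sub_prod_relPos_le n _
    _ = ENNReal.ofReal (24 * π / (n + 2)) := by
        rw [setLIntegral_const, mul_left_comm, ofReal_pi_inv_mul_volume, mul_one]

/-- There is a constant `c > 0` such that for every `n ≥ 1` the expected Favard
length of the `n`-th generation random Cantor disks is at most `c / n`. -/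
theorem expected_favard_length_le :
    ∃ c : ℝ, 0 < c ∧ ∀ n : ℕ, 1 ≤ n →
      (∫ ω, favLength (cantorDisks ω) ∂(treeMeasure n)) ≤ c / n := by
  refine ⟨24 * π, by positivity, fun n hn => ?_⟩
  have hn' : (0 : ℝ) < n := by exact_mod_cast hn
  have h := (ofReal_integral_le_lintegral (treeMeasure n)
    fun ω => favLength_nonneg (cantorDisks ω)).trans (lintegral_favLength_le n)
  rw [ENNReal.ofReal_le_ofReal_iff (by positivity)] at h
  refine h.trans ?_
  gcongr
  linarith

end
end

section
/- For every ω ∈ ℝ and every t ∈ ℝ, the vertical line {z ∈ ℂ : Re z = t} intersects at most two of the four closed disks B̄((3/4)·e^{i(α·π/2 − ω)}, 1/4), α ∈ {0,1,2,3}. Equivalently, every point of ℝ belongs to at most two of the four intervals [(3/4)cos(α·π/2 − ω) − 1/4, (3/4)cos(α·π/2 − ω) + 1/4], α ∈ {0,1,2,3}. -/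
open Real Set

/-- Four intervals of radius `1 / 4` with centers `(3 / 4) d α`, where `d` changes sign under a
half-turn of the indices and consecutive values have squares summing to one: no three of them share
a point. -/
lemma ncard_setOf_mem_Icc_le_two {d : Fin 4 → ℝ} (hneg : ∀ i, d (i + 2) = -d i)
    (hsq : ∀ i, d i ^ 2 + d (i + 1) ^ 2 = 1) (t : ℝ) :
    {α : Fin 4 | t ∈ Set.Icc (3 / 4 * d α - 1 / 4) (3 / 4 * d α + 1 / 4)}.ncard ≤ 2 := by
  by_contra! hcard
  obtain ⟨a, b, c, ha, hb, hc, hab, hac, hbc⟩ := (Set.two_lt_ncard_iff (Set.toFinite _)).1 hcard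
  have hconsec : ∀ a b c : Fin 4, a ≠ b → a ≠ c → b ≠ c → ∃ i : Fin 4,
      i ∈ ({a, b, c} : Finset (Fin 4)) ∧ i + 1 ∈ ({a, b, c} : Finset (Fin 4)) ∧
        i + 2 ∈ ({a, b, c} : Finset (Fin 4)) := by
    decide
  obtain ⟨i, hi₀, hi₁, hi₂⟩ := hconsec a b c hab hac hbc
  have hmem : ∀ j ∈ ({a, b, c} : Finset (Fin 4)),
      3 / 4 * d j - 1 / 4 ≤ t ∧ t ≤ 3 / 4 * d j + 1 / 4 := by
    intro j hj
    simp only [Finset.mem_insert, Finset.mem_singleton] at hj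
    rcases hj with rfl | rfl | rfl <;> assumption
  have h₀ := hmem _ hi₀
  have h₁ := hmem _ hi₁
  have h₂ := hmem _ hi₂
  rw [hneg] at h₂
  have hsum : 1 ≤ |d i| + |d (i + 1)| := by
    nlinarith [hsq i, sq_abs (d i), sq_abs (d (i + 1)), abs_nonneg (d i), abs_nonneg (d (i + 1))]
  rcases abs_cases (d i) with hx | hx <;> rcases abs_cases (d (i + 1)) with hy | hy <;> linarith

lemma abs_re_sub_le_of_mem_closedBall {z w : ℂ} {r : ℝ} (hz : z ∈ Metric.closedBall w r) :
    |z.re - w.re| ≤ r := by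
  rw [← Complex.sub_re]
  exact (Complex.abs_re_le_norm _).trans (mem_closedBall_iff_norm.1 hz)

/-- A vertical line meets at most two of the four first-generation disks
`B̄((3/4)e^{i(απ/2 − ω)}, 1/4)`, `α ∈ {0,1,2,3}`; equivalently, every real number lies in
at most two of the four projected intervals. -/
theorem vline_meets_at_most_two_disks (ω t : ℝ) :
    {α : Fin 4 |
        ({z : ℂ | z.re = t} ∩
          Metric.closedBall
            ((3 / 4 : ℂ) *
              Complex.exp (((((α : ℕ) : ℝ) * (π / 2) - ω : ℝ) : ℂ) * Complex.I))
            (1 / 4)).Nonempty}.ncard ≤ 2 ∧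
      {α : Fin 4 |
        t ∈ Set.Icc (3 / 4 * Real.cos (((α : ℕ) : ℝ) * (π / 2) - ω) - 1 / 4)
          (3 / 4 * Real.cos (((α : ℕ) : ℝ) * (π / 2) - ω) + 1 / 4)}.ncard ≤ 2 := by
  have hIcc : {α : Fin 4 |
        t ∈ Set.Icc (3 / 4 * Real.cos (((α : ℕ) : ℝ) * (π / 2) - ω) - 1 / 4)
          (3 / 4 * Real.cos (((α : ℕ) : ℝ) * (π / 2) - ω) + 1 / 4)}.ncard ≤ 2 := by
    have h₁ : Real.cos (π / 2 - ω) = Real.sin ω := Real.cos_pi_div_two_sub ω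
    have h₂ : Real.cos (2 * (π / 2) - ω) = -Real.cos ω := by
      rw [mul_div_cancel₀ π two_ne_zero, Real.cos_pi_sub]
    have h₃ : Real.cos (3 * (π / 2) - ω) = -Real.sin ω := by
      rw [show 3 * (π / 2) - ω = π / 2 - ω + π by ring, Real.cos_add_pi, h₁]
    apply ncard_setOf_mem_Icc_le_two (d := fun α : Fin 4 ↦ Real.cos (((α : ℕ) : ℝ) * (π / 2) - ω))
    · intro i
      fin_cases i <;> simp [h₁, h₂, h₃]
    · intro i
      fin_cases i <;> simp [h₁, h₂, h₃]
  refine ⟨(Set.ncard_le_ncard ?_ (Set.toFinite _)).trans hIcc, hIcc⟩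
  rintro α ⟨z, rfl, hz⟩
  have hre := abs_le.1 (abs_re_sub_le_of_mem_closedBall hz)
  rw [show (3 / 4 : ℂ) = ((3 / 4 : ℝ) : ℂ) by norm_num, Complex.re_ofReal_mul,
    Complex.exp_ofReal_mul_I_re] at hre
  constructor <;> linarith [hre.1, hre.2]
end
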